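/- For every ε > 0 there exist infinitely many positive integers N for which there is a set A ⊆ {1,…,N} × {1,…,N} containing no corner and satisfying #A ≥ 2^{-(c+ε)·√(log₂ N)} · N², where c = 2·√(2·log₂(4/3)). -/

import Mathlib

/-- A set `A ⊆ ℤ²` is corner-free if it contains no corner, i.e. no three points
`(x, y), (x + d, y), (x, y + d)` with `d ≠ 0`. -/
def CornerFreeZ2 (A : Set (ℤ × ℤ)) : Prop :=
  ∀ x y d : ℤ, d ≠ 0 → ¬((x, y) ∈ A ∧ (x + d, y) ∈ A ∧ (x, y + d) ∈ A)

lemma digits_zero (q : ℤ) : ∀ (d : ℕ) (h : Fin d → ℤ), (∀ i, |h i| < q) →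
    ∑ i, h i * q ^ (i : ℕ) = 0 → ∀ i, h i = 0 := by
  intro d
  induction d with
  | zero => intro h _ _ i; exact i.elim0
  | succ d ih =>
    intro h hb hs
    have hq : 0 < q := lt_of_le_of_lt (abs_nonneg _) (hb 0)
    rw [Fin.sum_univ_succ] at hs
    have e : ∑ i : Fin d, h i.succ * q ^ ((i.succ : Fin (d+1)) : ℕ)
        = q * ∑ i : Fin d, h i.succ * q ^ (i : ℕ) := by
      rw [Finset.mul_sum]
      refine Finset.sum_congr rfl fun i _ => ?_
      rw [Fin.val_succ, pow_succ]; ring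
    rw [e] at hs
    simp only [Fin.val_zero, pow_zero, mul_one] at hs
    have h0 : h 0 = 0 := by
      apply Int.eq_zero_of_abs_lt_dvd (m := q) _ (hb 0)
      exact ⟨-∑ i : Fin d, h i.succ * q ^ (i : ℕ), by linarith⟩
    have h1 : ∑ i : Fin d, h i.succ * q ^ (i : ℕ) = 0 := by
      rw [h0, zero_add] at hs
      exact (mul_eq_zero.mp hs).resolve_left hq.ne'
    intro i
    refine Fin.cases h0 (fun j => ?_) i
    exact ih (fun j => h j.succ) (fun j => hb _) h1 j

lemma digits_bound (q : ℤ) : ∀ (d : ℕ) (h : Fin d → ℤ), (∀ i, 0 ≤ h i ∧ h i < q) →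
    0 ≤ ∑ i, h i * q ^ (i : ℕ) ∧ ∑ i, h i * q ^ (i : ℕ) < q ^ d := by
  intro d
  induction d with
  | zero => intro h _; simp
  | succ d ih =>
    intro h hb
    have hq : 0 < q := lt_of_le_of_lt (hb 0).1 (hb 0).2
    rw [Fin.sum_univ_castSucc]
    obtain ⟨h1, h2⟩ := ih (fun j => h j.castSucc) (fun j => hb _)
    obtain ⟨h3, h4⟩ := hb (Fin.last d)
    simp only [Fin.val_castSucc, Fin.val_last]
    have hp : 0 < q ^ d := pow_pos hq d
    constructor
    · positivity
    · rw [pow_succ]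
      nlinarith

/-- Admissible digit pairs. -/
noncomputable def digitPairs (m : ℕ) : Finset (ℤ × ℤ) :=
  (Finset.Ico 0 (2 * m : ℤ) ×ˢ Finset.Ico 0 (2 * m : ℤ)).filter
    fun p => (m : ℤ) ≤ p.1 + p.2 ∧ p.1 + p.2 < 3 * m

lemma mem_digitPairs (m : ℕ) (p : ℤ × ℤ) : p ∈ digitPairs m ↔
    ((0 ≤ p.1 ∧ p.1 < 2 * m) ∧ (0 ≤ p.2 ∧ p.2 < 2 * m)) ∧
      ((m : ℤ) ≤ p.1 + p.2 ∧ p.1 + p.2 < 3 * m) := by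
  simp [digitPairs]

lemma card_digitPairs (m : ℕ) : 3 * m ^ 2 ≤ (digitPairs m).card := by
  have : (Finset.range m ×ˢ Finset.range (3 * m)).card = 3 * m ^ 2 := by
    simp; ring
  rw [← this]
  refine Finset.card_le_card_of_injOn
    (fun p => if p.2 < m + p.1 then ((p.1 : ℤ), (m : ℤ) - p.1 + p.2)
      else ((p.1 : ℤ) + m, (p.2 : ℤ) - m - p.1)) ?_ ?_
  · rintro ⟨a, t⟩ h
    simp only [Finset.coe_product, Finset.coe_range, Set.mem_prod, Set.mem_Iio] at h
    rw [Finset.mem_coe, mem_digitPairs]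
    dsimp only
    split_ifs <;> dsimp only <;> omega
  · rintro ⟨a, t⟩ h ⟨b, s⟩ h' he
    simp only [Finset.coe_product, Finset.coe_range, Set.mem_prod, Set.mem_Iio] at h h'
    dsimp only at he
    split_ifs at he <;> simp only [Prod.mk.injEq] at he ⊢ <;> omega

/-- Encoding a vector of digit pairs. -/
def enc (m d : ℕ) (z : Fin d → ℤ × ℤ) : ℤ × ℤ :=
  (∑ i, (z i).1 * (2 * m : ℤ) ^ (i : ℕ) + 1, ∑ i, (z i).2 * (2 * m : ℤ) ^ (i : ℕ) + 1)

lemma comb (m d : ℕ) (hm : 0 < m) (hd : 0 < d) : ∃ A : Finset (ℤ × ℤ),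
    A ⊆ Finset.Icc 1 (((2 * m) ^ d : ℕ) : ℤ) ×ˢ Finset.Icc 1 (((2 * m) ^ d : ℕ) : ℤ) ∧
    CornerFreeZ2 (A : Set (ℤ × ℤ)) ∧
    (3 * (m : ℝ) ^ 2) ^ d / (d * (2 * m) ^ 2) ≤ (A.card : ℝ) := by
  classical
  set P := Fintype.piFinset (fun _ : Fin d => digitPairs m) with hP
  have memP : ∀ z, z ∈ P ↔ ∀ i, z i ∈ digitPairs m := by
    intro z; simp [hP]
  have cardP : (3 * m ^ 2) ^ d ≤ P.card := by
    simp only [hP, Fintype.card_piFinset, Finset.prod_const, Finset.card_univ, Fintype.card_fin]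
    exact Nat.pow_le_pow_left (card_digitPairs m) d
  set f : (Fin d → ℤ × ℤ) → ℤ := fun z => ∑ i, ((z i).1 - (z i).2) ^ 2 with hf
  have maps : ∀ z ∈ P, f z ∈ Finset.Ico (0 : ℤ) ((d * (2 * m) ^ 2 : ℕ) : ℤ) := by
    intro z hz
    rw [memP] at hz
    rw [Finset.mem_Ico]
    refine ⟨Finset.sum_nonneg fun i _ => sq_nonneg _, ?_⟩
    have : Nonempty (Fin d) := ⟨⟨0, hd⟩⟩
    calc f z < ∑ i : Fin d, ((2 * m : ℤ)) ^ 2 := by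
          apply Finset.sum_lt_sum_of_nonempty Finset.univ_nonempty
          intro i _
          have := (mem_digitPairs m _).1 (hz i)
          apply sq_lt_sq'  <;> omega
      _ = _ := by simp
  have hpos : 0 < d * (2 * m) ^ 2 := by positivity
  obtain ⟨r, -, hr⟩ := Finset.exists_le_card_fiber_of_nsmul_le_card_of_maps_to
    (b := (3 * (m : ℝ) ^ 2) ^ d / (d * (2 * m) ^ 2)) maps
    ⟨0, by rw [Finset.mem_Ico]; exact ⟨le_rfl, by exact_mod_cast hpos⟩⟩ (by
      rw [Int.card_Ico, nsmul_eq_mul, sub_zero, Int.toNat_natCast]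
      have hp' : (0 : ℝ) < d * (2 * m) ^ 2 := by exact_mod_cast hpos
      push_cast
      rw [mul_div_cancel₀ _ hp'.ne']
      exact_mod_cast cardP)
  have inj : Set.InjOn (enc m d) (P.filter fun z => f z = r : Finset _) := by
    intro z hz w hw he
    simp only [Finset.coe_filter, Set.mem_ofPred_eq, memP] at hz hw
    simp only [enc, Prod.mk.injEq] at he
    have h1 := digits_zero (2 * m) d (fun i => (z i).1 - (w i).1) (fun i => by
      have := (mem_digitPairs m _).1 (hz.1 i)
      have := (mem_digitPairs m _).1 (hw.1 i)
      rw [abs_lt]; omega) (by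
      simp only [sub_mul, Finset.sum_sub_distrib]; linarith [he.1])
    have h2 := digits_zero (2 * m) d (fun i => (z i).2 - (w i).2) (fun i => by
      have := (mem_digitPairs m _).1 (hz.1 i)
      have := (mem_digitPairs m _).1 (hw.1 i)
      rw [abs_lt]; omega) (by
      simp only [sub_mul, Finset.sum_sub_distrib]; linarith [he.2])
    funext i
    exact Prod.ext (sub_eq_zero.1 (h1 i)) (sub_eq_zero.1 (h2 i))
  refine ⟨(P.filter fun z => f z = r).image (enc m d), ?_, ?_, ?_⟩
  · intro p hp
    obtain ⟨z, hz, rfl⟩ := Finset.mem_image.1 hp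
    rw [Finset.mem_filter, memP] at hz
    have h1 := digits_bound (2 * m) d (fun i => (z i).1)
      (fun i => ((mem_digitPairs m _).1 (hz.1 i)).1.1)
    have h2 := digits_bound (2 * m) d (fun i => (z i).2)
      (fun i => ((mem_digitPairs m _).1 (hz.1 i)).1.2)
    simp only [Finset.mem_product, Finset.mem_Icc, enc]
    push_cast
    refine ⟨⟨?_, ?_⟩, ?_, ?_⟩ <;> linarith [h1.1, h1.2, h2.1, h2.2]
  · rintro x y t ht ⟨ha, hb, hc⟩
    simp only [Finset.coe_image, Finset.coe_filter, Set.mem_image, Set.mem_ofPred_eq, memP] at ha hb hc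
    obtain ⟨u, ⟨hu, hur⟩, hue⟩ := ha
    obtain ⟨v, ⟨hv, hvr⟩, hve⟩ := hb
    obtain ⟨w, ⟨hw, hwr⟩, hwe⟩ := hc
    simp only [enc, Prod.mk.injEq] at hue hve hwe
    obtain ⟨u1, u2⟩ := hue
    obtain ⟨v1, v2⟩ := hve
    obtain ⟨w1, w2⟩ := hwe
    -- same digits
    have e1 := digits_zero (2 * m) d (fun i => (u i).1 - (w i).1) (fun i => by
      have := (mem_digitPairs m _).1 (hu i)
      have := (mem_digitPairs m _).1 (hw i)
      rw [abs_lt]; omega) (by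
      simp only [sub_mul, Finset.sum_sub_distrib]; linarith)
    have e2 := digits_zero (2 * m) d (fun i => (u i).2 - (v i).2) (fun i => by
      have := (mem_digitPairs m _).1 (hu i)
      have := (mem_digitPairs m _).1 (hv i)
      rw [abs_lt]; omega) (by
      simp only [sub_mul, Finset.sum_sub_distrib]; linarith)
    have e3 := digits_zero (2 * m) d (fun i => ((v i).1 + (v i).2) - ((w i).1 + (w i).2))
      (fun i => by
      have := (mem_digitPairs m _).1 (hv i)
      have := (mem_digitPairs m _).1 (hw i)
      rw [abs_lt]; omega) (by
      simp only [sub_mul, add_mul, Finset.sum_sub_distrib, Finset.sum_add_distrib]; linarith)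
    have key : ∑ i, 2 * ((v i).1 - (u i).1) ^ 2 = f v + f w - 2 * f u := by
      simp only [hf]
      rw [Finset.mul_sum, ← Finset.sum_add_distrib, ← Finset.sum_sub_distrib]
      refine Finset.sum_congr rfl fun i _ => ?_
      have a1 : (w i).1 = (u i).1 := by linarith [e1 i]
      have a2 : (v i).2 = (u i).2 := by linarith [e2 i]
      have a3 : (w i).2 = (v i).1 + (u i).2 - (u i).1 := by linarith [e3 i]
      rw [a1, a2, a3]; ring
    rw [hur, hvr, hwr, show r + r - 2 * r = 0 by ring,
      Finset.sum_eq_zero_iff_of_nonneg (fun i _ => by positivity)] at key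
    apply ht
    have : ∑ i, (v i).1 * (2 * m : ℤ) ^ (i : ℕ) = ∑ i, (u i).1 * (2 * m : ℤ) ^ (i : ℕ) := by
      refine Finset.sum_congr rfl fun i _ => ?_
      have h := key i (Finset.mem_univ i)
      have : (v i).1 - (u i).1 = 0 := by
        apply pow_eq_zero_iff (two_ne_zero) |>.1; linarith
      rw [sub_eq_zero.1 this]
    linarith
  · rw [Finset.card_image_of_injOn inj]
    exact hr

lemma asym (a ε : ℝ) (ha : 0 < a) (ha1 : a ≤ 1) (hε : 0 < ε) (M : ℕ) :
    ∃ k d : ℕ, M < k ∧ 0 < k ∧ 0 < d ∧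
      a * d + 2 * k + Real.logb 2 d ≤ (2 * √(2 * a) + ε) * √(k * d) := by
  have hlim : Filter.Tendsto (fun k : ℕ => (a + Real.logb 2 (3 / a) + Real.logb 2 k) / k)
      Filter.atTop (nhds 0) := by
    have h1 : Filter.Tendsto (fun x : ℝ => Real.log x / x) Filter.atTop (nhds 0) := by
      simpa using Real.isLittleO_log_id_atTop.tendsto_div_nhds_zero
    have h2 := h1.comp (tendsto_natCast_atTop_atTop (R := ℝ))
    have h3 := tendsto_const_div_atTop_nhds_zero_nat (a + Real.logb 2 (3 / a))
    have h4 := h3.add (h2.const_mul (1 / Real.log 2))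
    simp only [mul_zero, add_zero] at h4
    refine h4.congr fun k => ?_
    simp only [Function.comp, Real.logb]
    ring
  obtain ⟨k, h1, h2⟩ := ((hlim.eventually_lt_const hε).and
    (Filter.eventually_gt_atTop M)).exists
  have hk : 0 < k := by omega
  have hkR : (1 : ℝ) ≤ k := by exact_mod_cast hk
  have hk0 : (0 : ℝ) < k := by linarith
  rw [div_lt_iff₀ hk0] at h1
  have hdl := Nat.le_ceil (2 * k / a)
  have hdu := Nat.ceil_lt_add_one (a := 2 * k / a) (by positivity)
  set d := ⌈2 * k / a⌉₊
  have hd0 : (0 : ℝ) < d := lt_of_lt_of_le (by positivity) hdl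
  refine ⟨k, d, h2, hk, by exact_mod_cast hd0, ?_⟩
  have had : a * d ≤ 2 * k + a := by
    have : a * d ≤ a * (2 * k / a + 1) := by gcongr
    rwa [mul_add, mul_div_cancel₀ _ ha.ne', mul_one] at this
  have had' : 2 * k ≤ a * d := by
    rw [div_le_iff₀ ha] at hdl; linarith
  have hlog : Real.logb 2 d ≤ Real.logb 2 (3 / a) + Real.logb 2 k := by
    rw [← Real.logb_mul (by positivity) hk0.ne']
    apply Real.logb_le_logb_of_le one_lt_two hd0
    rw [div_mul_eq_mul_div, le_div_iff₀ ha]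
    nlinarith
  have hs1 : (k : ℝ) ≤ √(k * d) := by
    apply Real.le_sqrt_of_sq_le
    nlinarith
  have hs2 : 2 * (k : ℝ) ≤ √(2 * a) * √(k * d) := by
    rw [← Real.sqrt_mul (by positivity)]
    apply Real.le_sqrt_of_sq_le
    nlinarith
  nlinarith

/-- For every ε > 0 there exist infinitely many positive integers N for which there is a
corner-free set A ⊆ {1,…,N}² with #A ≥ 2^{-(c+ε)·√(log₂ N)} · N², where
c = 2·√(2·log₂(4/3)). -/
theorem corner_free_lower_bound (ε : ℝ) (hε : 0 < ε) :
    ∀ M : ℕ, ∃ N : ℕ, M < N ∧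
      ∃ A : Finset (ℤ × ℤ),
        A ⊆ Finset.Icc 1 (N : ℤ) ×ˢ Finset.Icc 1 (N : ℤ) ∧
        CornerFreeZ2 (A : Set (ℤ × ℤ)) ∧
        (2 : ℝ) ^ (-(2 * Real.sqrt (2 * Real.logb 2 (4 / 3)) + ε) *
            Real.sqrt (Real.logb 2 N)) * (N : ℝ) ^ 2 ≤ (A.card : ℝ) := by
  intro M
  have ha : 0 < Real.logb 2 (4 / 3) := Real.logb_pos one_lt_two (by norm_num)
  have ha1 : Real.logb 2 (4 / 3) ≤ 1 := by
    rw [Real.logb_le_iff_le_rpow one_lt_two (by norm_num)]; norm_num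
  obtain ⟨k, d, hM, hk, hd, hle⟩ := asym _ ε ha ha1 hε M
  obtain ⟨j, rfl⟩ : ∃ j, k = j + 1 := ⟨k - 1, by omega⟩
  obtain ⟨A, h1, h2, h3⟩ := comb (2 ^ j) d (by positivity) hd
  have hN : (2 * 2 ^ j) ^ d = 2 ^ ((j + 1) * d) := by rw [← pow_succ', pow_mul]
  refine ⟨(2 * 2 ^ j) ^ d, ?_, A, h1, h2, le_trans ?_ h3⟩
  · rw [hN]
    calc M < j + 1 := hM
      _ ≤ (j + 1) * d := Nat.le_mul_of_pos_right _ hd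
      _ < _ := Nat.lt_two_pow_self
  · have hd0 : (0 : ℝ) < d := by exact_mod_cast hd
    have hlogN : Real.logb 2 (((2 * 2 ^ j) ^ d : ℕ) : ℝ) = ((j + 1 : ℕ) : ℝ) * d := by
      rw [hN]; push_cast
      rw [Real.logb_pow, Real.logb_self_eq_one one_lt_two]; push_cast; ring
    rw [hlogN]
    set m : ℝ := ((2 ^ j : ℕ) : ℝ) with hm
    have hm0 : 0 < m := by rw [hm]; positivity
    have e1 : (2 : ℝ) ^ (-(Real.logb 2 (4 / 3) * d + 2 * ((j + 1 : ℕ) : ℝ) + Real.logb 2 d))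
        = (3 / 4) ^ d / (d * (2 * m) ^ 2) := by
      rw [Real.rpow_neg two_pos.le, Real.rpow_add two_pos, Real.rpow_add two_pos,
        Real.rpow_mul two_pos.le, Real.rpow_logb two_pos (by norm_num) (by norm_num),
        Real.rpow_logb two_pos (by norm_num) hd0, Real.rpow_natCast, mul_comm 2 ((j + 1 : ℕ) : ℝ),
        Real.rpow_mul two_pos.le, Real.rpow_natCast, hm, show (3 / 4 : ℝ) = (4 / 3)⁻¹ by norm_num,
        inv_pow]
      push_cast
      rw [Real.rpow_two, ← pow_succ']
      field_simp
    calc _ ≤ (2 : ℝ) ^ (-(Real.logb 2 (4 / 3) * d + 2 * ((j + 1 : ℕ) : ℝ) + Real.logb 2 d))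
          * (((2 * 2 ^ j) ^ d : ℕ) : ℝ) ^ 2 := by
          gcongr
          · exact one_le_two
          · linarith
      _ = _ := by
          rw [e1]
          have : (((2 * 2 ^ j) ^ d : ℕ) : ℝ) = (2 * m) ^ d := by rw [hm]; push_cast; ring
          rw [this, div_mul_eq_mul_div, ← pow_mul, mul_comm d 2, pow_mul, ← mul_pow]
          congr 2
          ring
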